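/- For all integers 0 ≤ k ≤ i, one has the explicit formula P_{k,i}^{(2)}(q) = q^{2·C(i−k,2) − 2·C(k+1,2) + i} · [2k choose i]_q · [i choose k]_q^2, where C(m,2) = m(m−1)/2. Equivalently, with f(k,r) = r·C(k+1,2) and g(i,r) = (r−2)·C(i,2) − i, the Laurent polynomial T_{k,i}^{(2)}(q) = q^{f(k,2)+g(i,2)} P_{k,i}^{(2)}(q) equals q^{2·C(i−k,2)} · [2k choose i]_q · [i choose k]_q^2. -/

import Mathlib

open Polynomial LaurentPolynomial Finset

/-- The Gaussian (q-)binomial coefficient `[n choose k]_q` as a polynomial in `q`,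
defined by the q-Pascal recursion; it equals `(q)_n / ((q)_k (q)_{n-k})` for `0 ≤ k ≤ n`
and vanishes for `k > n`. -/
noncomputable def qbinom : ℕ → ℕ → Polynomial ℤ
  | _, 0 => 1
  | 0, _ + 1 => 0
  | n + 1, k + 1 => qbinom n k + Polynomial.X ^ (k + 1) * qbinom n (k + 1)

/-- `[n choose k]_q` viewed as a Laurent polynomial. -/
noncomputable def qb (n k : ℕ) : LaurentPolynomial ℤ := (qbinom n k).toLaurent

theorem qbinom_zero_right (n : ℕ) : qbinom n 0 = 1 := by
  cases n <;> rfl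

theorem qbinom_succ_succ (n k : ℕ) :
    qbinom (n + 1) (k + 1) = qbinom n k + X ^ (k + 1) * qbinom n (k + 1) := rfl

theorem qbinom_eq_zero_of_lt {n k : ℕ} (h : n < k) : qbinom n k = 0 := by
  induction n generalizing k with
  | zero =>
    obtain ⟨k, rfl⟩ := Nat.exists_eq_add_of_lt h
    rw [zero_add]
    rfl
  | succ n ih =>
    obtain ⟨k, rfl⟩ : ∃ l, k = l + 1 := ⟨k - 1, by omega⟩
    rw [qbinom_succ_succ, ih (by omega), ih (by omega), mul_zero, add_zero]

theorem qbinom_self (n : ℕ) : qbinom n n = 1 := by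
  induction n with
  | zero => rfl
  | succ n ih => rw [qbinom_succ_succ, ih, qbinom_eq_zero_of_lt (Nat.lt_succ_self n), mul_zero,
      add_zero]

/-- The `q`-Pochhammer symbol `(q)_n`. -/
noncomputable def qPoch (n : ℕ) : Polynomial ℤ := ∏ j ∈ range n, (1 - X ^ (j + 1))

theorem qPoch_succ (n : ℕ) : qPoch (n + 1) = qPoch n * (1 - X ^ (n + 1)) :=
  prod_range_succ _ _

theorem qPoch_ne_zero (n : ℕ) : qPoch n ≠ 0 := by
  refine prod_ne_zero_iff.mpr fun j _ h => ?_
  simpa using congrArg (Polynomial.eval 0) h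

theorem qbinom_add_mul_qPoch (a b : ℕ) :
    qbinom (a + b) a * (qPoch a * qPoch b) = qPoch (a + b) := by
  induction a generalizing b with
  | zero => simp [qbinom_zero_right, qPoch]
  | succ a iha =>
    induction b with
    | zero => simp [qbinom_self, qPoch]
    | succ b ihb =>
      have h₁ := iha (b + 1)
      have e : a + 1 + (b + 1) = a + 1 + b + 1 := by ring
      have e' : a + (b + 1) = a + 1 + b := by ring
      rw [e, qbinom_succ_succ]
      rw [e'] at h₁
      rw [qPoch_succ b] at h₁ ⊢
      rw [qPoch_succ (a + 1 + b)]
      rw [qPoch_succ a] at ihb ⊢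
      linear_combination (1 - X ^ (a + 1)) * h₁ + X ^ (a + 1) * (1 - X ^ (b + 1)) * ihb

theorem qbinom_add_symm (a b : ℕ) : qbinom (a + b) a = qbinom (a + b) b := by
  have h₁ := qbinom_add_mul_qPoch a b
  have h₂ := qbinom_add_mul_qPoch b a
  rw [add_comm b a, mul_comm (qPoch b)] at h₂
  exact mul_right_cancel₀ (mul_ne_zero (qPoch_ne_zero a) (qPoch_ne_zero b)) (h₁.trans h₂.symm)

theorem qbinom_ne_zero (a b : ℕ) : qbinom (a + b) a ≠ 0 := fun h => by
  have := qbinom_add_mul_qPoch a b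
  rw [h, zero_mul] at this
  exact qPoch_ne_zero _ this.symm

theorem qbinom_mul_qbinom (a b c : ℕ) :
    qbinom (a + b + c) (a + b) * qbinom (a + b) a
      = qbinom (a + b + c) a * qbinom (b + c) b := by
  have h₁ := qbinom_add_mul_qPoch (a + b) c
  have h₂ := qbinom_add_mul_qPoch a b
  have h₃ := qbinom_add_mul_qPoch a (b + c)
  have h₄ := qbinom_add_mul_qPoch b c
  rw [← add_assoc] at h₃
  refine mul_right_cancel₀ (mul_ne_zero (mul_ne_zero (qPoch_ne_zero a) (qPoch_ne_zero b))
    (qPoch_ne_zero c)) ?_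
  linear_combination qbinom (a + b + c) (a + b) * qPoch c * h₂ + h₁ - h₃
    - qbinom (a + b + c) a * qPoch a * h₄

/-- The `q`-Vandermonde convolution. -/
theorem qbinom_add_eq_sum (a b c : ℕ) :
    qbinom (a + b) c
      = ∑ u ∈ antidiagonal c, X ^ ((a - u.1) * u.2) * qbinom a u.1 * qbinom b u.2 := by
  induction a generalizing c with
  | zero =>
    rw [sum_eq_single (0, c)]
    · simp [qbinom_zero_right]
    · rintro ⟨u, v⟩ huv hne
      have hu : 0 < u := by
        rcases Nat.eq_zero_or_pos u with rfl | hu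
        · simp_all
        · exact hu
      simp [qbinom_eq_zero_of_lt hu]
    · simp
  | succ a ih =>
    cases c with
    | zero => simp [qbinom_zero_right]
    | succ c =>
      have e : a + 1 + b = a + b + 1 := by ring
      rw [e, qbinom_succ_succ, ih c, ih (c + 1), Nat.sum_antidiagonal_succ,
        Nat.sum_antidiagonal_succ, mul_add, mul_sum, ← add_assoc, add_comm (∑ _ ∈ _, _), add_assoc,
        ← sum_add_distrib]
      congr 1
      · simp only [qbinom_zero_right, Nat.sub_zero]
        ring
      · refine sum_congr rfl fun u hu => ?_
        obtain ⟨u, v⟩ := u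
        have huv : u + v = c := by simpa using hu
        simp only [qbinom_succ_succ, Nat.add_sub_add_right]
        rcases le_or_gt (u + 1) a with h | h
        · obtain ⟨d, rfl⟩ := Nat.exists_eq_add_of_le h
          have e₁ : u + 1 + d - u = d + 1 := by omega
          have e₂ : u + 1 + d - (u + 1) = d := by omega
          rw [e₁, e₂, ← huv]
          ring
        · rw [qbinom_eq_zero_of_lt h]
          ring

/-- The `q`-Vandermonde convolution, with the complementary power of `q`. -/
theorem qbinom_add_eq_sum_sq (a j : ℕ) :
    qbinom (a + j) j = ∑ l ∈ range (j + 1), X ^ (l * l) * qbinom a l * qbinom j l := by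
  rw [add_comm, qbinom_add_eq_sum, Nat.sum_antidiagonal_eq_sum_range_succ_mk, ← sum_range_reflect]
  refine sum_congr rfl fun l hl => ?_
  obtain ⟨d, rfl⟩ := Nat.exists_eq_add_of_le (Nat.lt_succ_iff.mp (mem_range.mp hl))
  have e₁ : l + d + 1 - 1 - l = d := by omega
  have e₂ : l + d - d = l := by omega
  simp only [e₁, e₂]
  rw [qbinom_add_symm l d]
  ring

theorem sum_qbinom_mul_qbinom_sub (m k l : ℕ) (hlm : l ≤ m) (hlk : l ≤ k) (b : ℕ) :
    ∑ j ∈ range (k + 1), X ^ ((k - j) * (m - j)) * qbinom m j * qbinom b (k - j) * qbinom j l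
      = qbinom m l * qbinom (m - l + b) (k - l) := by
  obtain ⟨m, rfl⟩ := Nat.exists_eq_add_of_le hlm
  obtain ⟨k, rfl⟩ := Nat.exists_eq_add_of_le hlk
  have e : l + k + 1 = l + (k + 1) := by ring
  rw [Nat.add_sub_cancel_left, Nat.add_sub_cancel_left, qbinom_add_eq_sum m b k,
    Nat.sum_antidiagonal_eq_sum_range_succ_mk, mul_sum, e, sum_range_add, sum_eq_zero, zero_add]
  · refine sum_congr rfl fun j hj => ?_
    have e₁ : l + k - (l + j) = k - j := by omega
    have e₂ : l + m - (l + j) = m - j := by omega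
    simp only [e₁, e₂]
    rcases le_or_gt j m with h | h
    · obtain ⟨d, rfl⟩ := Nat.exists_eq_add_of_le h
      have h₁ := qbinom_mul_qbinom l j d
      rw [← add_assoc, mul_comm (k - j)]
      linear_combination X ^ ((j + d - j) * (k - j)) * qbinom b (k - j) * h₁
    · rw [qbinom_eq_zero_of_lt h, qbinom_eq_zero_of_lt (Nat.add_lt_add_left h l)]
      ring
  · intro j hj
    rw [qbinom_eq_zero_of_lt (mem_range.mp hj), mul_zero]

/-- An instance of the `q`-Pfaff–Saalschütz summation. -/
theorem qbinom_mul_qbinom_eq_sum (m k : ℕ) :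
    qbinom (m + k) k * qbinom (m + 2 * k) k
      = ∑ j ∈ range (k + 1), X ^ ((k - j) * (m - j)) * qbinom m j * qbinom (2 * k) (k - j)
          * qbinom (m + 2 * k + j) j := by
  have hexp : ∀ j ∈ range (k + 1), qbinom (m + 2 * k + j) j
      = ∑ l ∈ range (k + 1), X ^ (l * l) * qbinom (m + 2 * k) l * qbinom j l := fun j hj => by
    rw [qbinom_add_eq_sum_sq]
    refine sum_subset (range_subset_range.mpr (by have := mem_range.mp hj; omega))
      fun l _ hl => ?_
    rw [qbinom_eq_zero_of_lt (show j < l by simpa using hl), mul_zero]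
  rw [sum_congr rfl fun j hj => by rw [hexp j hj, mul_sum], sum_comm, qbinom_add_eq_sum_sq,
    sum_mul]
  refine sum_congr rfl fun l hl => ?_
  have hlk : l ≤ k := Nat.lt_succ_iff.mp (mem_range.mp hl)
  rcases le_or_gt l m with hlm | hlm
  · have h := sum_qbinom_mul_qbinom_sub m k l hlm hlk (2 * k)
    calc
      _ = X ^ (l * l) * qbinom (m + 2 * k) l * (qbinom m l * qbinom (m - l + 2 * k) (k - l)) := by
        obtain ⟨d, rfl⟩ := Nat.exists_eq_add_of_le hlk
        obtain ⟨c, rfl⟩ := Nat.exists_eq_add_of_le hlm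
        have h₁ := qbinom_mul_qbinom l d (l + c + (l + d))
        have e₁ : l + d + (l + c + (l + d)) = l + c + 2 * (l + d) := by ring
        have e₂ : d + (l + c + (l + d)) = c + 2 * (l + d) := by ring
        rw [e₁, e₂] at h₁
        rw [Nat.add_sub_cancel_left, Nat.add_sub_cancel_left]
        linear_combination X ^ (l * l) * qbinom (l + c) l * h₁
      _ = _ := by
        rw [← h, mul_sum]
        exact sum_congr rfl fun j _ => by ring
  · rw [qbinom_eq_zero_of_lt hlm, mul_zero, zero_mul, zero_mul, eq_comm]
    refine sum_eq_zero fun j _ => ?_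
    rcases lt_or_ge m j with h | h
    · rw [qbinom_eq_zero_of_lt h]
      ring
    · rw [qbinom_eq_zero_of_lt (h.trans_lt hlm)]
      ring

theorem qbinom_mul_qbinom_mul_sq (j k d : ℕ) :
    qbinom (j + d + k) (k + j) * qbinom (j + d + k + (k + j)) (k + j) * qbinom (k + j) k ^ 2
      = qbinom (j + d + k) k * qbinom (j + d + k + k) k
        * (qbinom (j + d) j * qbinom (j + d + 2 * k + j) j) := by
  have h₁ := qbinom_mul_qbinom k j d
  have h₃ := qbinom_mul_qbinom j k (j + d + k)
  have e₁ : k + j + d = j + d + k := by ring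
  have e₃ : j + k + (j + d + k) = j + d + k + (k + j) := by ring
  have e₄ : j + d + 2 * k + j = j + d + k + (k + j) := by ring
  have e₅ : k + (j + d + k) = j + d + k + k := by ring
  rw [e₁] at h₁
  rw [e₃, e₅, add_comm j k, ← qbinom_add_symm k j] at h₃
  rw [e₄]
  linear_combination qbinom (j + d + k + (k + j)) (k + j) * qbinom (k + j) k * h₁
    + qbinom (j + d + k) k * qbinom (j + d) j * h₃

theorem qb_def (n k : ℕ) : qb n k = (qbinom n k).toLaurent := rfl

theorem qb_eq_zero_of_lt {n k : ℕ} (h : n < k) : qb n k = 0 := by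
  rw [qb, qbinom_eq_zero_of_lt h, map_zero]

theorem qb_ne_zero (a b : ℕ) : qb (a + b) a ≠ 0 := by
  rw [qb, Ne, Polynomial.toLaurent_eq_zero]
  exact qbinom_ne_zero a b

theorem two_mul_cast_choose_two (n : ℕ) : 2 * (n.choose 2 : ℤ) = n * (n - 1) := by
  induction n with
  | zero => simp
  | succ n ih =>
    rw [Nat.choose_succ_succ' n 1, Nat.choose_one_right]
    push_cast
    linear_combination ih

/-- The explicit expansion of `([n choose k]_q [n+k choose k]_q)²`. -/
theorem qb_sq_mul_qb_sq_eq_sum (k n : ℕ) (hkn : k ≤ n) :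
    qb n k ^ 2 * qb (n + k) k ^ 2
      = ∑ i ∈ Icc k (min n (2 * k)),
          T ((((2 : ℕ) : ℤ) * k - i) * n) * qb n i * qb (n + i) i *
            (T (2 * ((i - k).choose 2 : ℤ) - 2 * (((k + 1).choose 2 : ℤ)) + (i : ℤ)) *
              qb (2 * k) i * qb i k ^ 2) := by
  obtain ⟨m, rfl⟩ := Nat.exists_eq_add_of_le' hkn
  have hsum := congrArg Polynomial.toLaurent (qbinom_mul_qbinom_eq_sum m k)
  rw [map_mul, map_sum] at hsum
  have e : m + 2 * k = m + k + k := by ring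
  have hfac : qb (m + k) k ^ 2 * qb (m + k + k) k ^ 2 = qb (m + k) k * qb (m + k + k) k *
      (qb (m + k) k * qb (m + k + k) k) := by ring
  have hIcc : Icc k (min (m + k) (2 * k)) = (range (min m k + 1)).map (addLeftEmbedding k) := by
    ext i
    simp only [mem_Icc, mem_map, mem_range, addLeftEmbedding_apply]
    constructor
    · intro h
      exact ⟨i - k, by omega, by omega⟩
    · rintro ⟨j, h, rfl⟩
      omega
  rw [hfac, hIcc, sum_map]
  conv_lhs => rw [← e]
  conv_lhs => enter [2]; rw [qb_def, qb_def, hsum]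
  rw [mul_sum]
  symm
  refine sum_subset_zero_on_sdiff (range_subset_range.mpr (by omega)) (fun j hj => ?_)
    (fun j hj => ?_)
  · simp only [mem_sdiff, mem_range] at hj
    rw [qbinom_eq_zero_of_lt (show m < j by omega)]
    simp
  · have hj := mem_range.mp hj
    obtain ⟨d, rfl⟩ := Nat.exists_eq_add_of_le (show j ≤ m by omega)
    obtain ⟨c, rfl⟩ := Nat.exists_eq_add_of_le (show j ≤ k by omega)
    have h := congrArg Polynomial.toLaurent (qbinom_mul_qbinom_mul_sq j (j + c) d)
    have hs := qbinom_add_symm c (j + c + j)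
    have e₁ : c + (j + c + j) = 2 * (j + c) := by ring
    have hexp : (((2 : ℕ) : ℤ) * (j + c : ℕ) - (j + c + j : ℕ)) * (j + d + (j + c) : ℕ)
        + (2 * (j.choose 2 : ℤ) - 2 * (((j + c + 1).choose 2 : ℤ)) + (j + c + j : ℕ))
          = (c * d : ℕ) := by
      rw [two_mul_cast_choose_two, two_mul_cast_choose_two]
      push_cast
      ring
    rw [e₁] at hs
    simp only [map_mul, map_pow] at h
    simp only [addLeftEmbedding_apply, Nat.add_sub_cancel_left, map_mul, map_pow,
      Polynomial.toLaurent_X, T_pow, mul_one] at h ⊢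
    rw [hs, ← hexp, T_add (_ * _)]
    simp only [← qb_def] at h ⊢
    rw [← e] at h
    linear_combination T ((((2 : ℕ) : ℤ) * (j + c : ℕ) - (j + c + j : ℕ)) * (j + d + (j + c) : ℕ))
      * T (2 * (j.choose 2 : ℤ) - 2 * (((j + c + 1).choose 2 : ℤ)) + (j + c + j : ℕ))
      * qb (2 * (j + c)) (j + c + j) * h

/-- For `0 ≤ k ≤ i` one has the explicit formula
`P_{k,i}^{(2)}(q) = q^{2C(i-k,2) - 2C(k+1,2) + i} [2k,i]_q [i,k]_q²`; equivalently, with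
`f(k,r) = r C(k+1,2)` and `g(i,r) = (r-2)C(i,2) - i` (so `f(k,2) + g(i,2) = 2C(k+1,2) - i`),
`T_{k,i}^{(2)}(q) = q^{f(k,2)+g(i,2)} P_{k,i}^{(2)}(q) = q^{2C(i-k,2)} [2k,i]_q [i,k]_q²`.
Here `P r k i` denotes the Laurent polynomial `P_{k,i}^{(r)}(q)` of Lemma 1.2,
characterized by the hypotheses. -/
theorem qSchmidt_P_two
    (P : ℕ → ℕ → ℕ → LaurentPolynomial ℤ)
    (hPsupp : ∀ r k i : ℕ, i < k ∨ r * k < i → P r k i = 0)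
    (hPnonneg : ∀ r k i : ℕ, ∀ m : ℤ, 0 ≤ (P r k i).coeff m)
    (hPid : ∀ r : ℕ, 1 ≤ r → ∀ k n : ℕ, k ≤ n →
      qb n k ^ r * qb (n + k) k ^ r
        = ∑ i ∈ Icc k (min n (r * k)),
            T (((r : ℤ) * k - i) * n) * qb n i * qb (n + i) i * P r k i)
    (k i : ℕ) (hki : k ≤ i) :
    P 2 k i
      = T (2 * ((i - k).choose 2 : ℤ) - 2 * (((k + 1).choose 2 : ℤ)) + (i : ℤ)) *
          qb (2 * k) i * qb i k ^ 2 ∧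
    T (2 * (((k + 1).choose 2 : ℤ)) - (i : ℤ)) * P 2 k i
      = T (2 * ((i - k).choose 2 : ℤ)) * qb (2 * k) i * qb i k ^ 2 := by
  have hmain : ∀ i, k ≤ i → P 2 k i
      = T (2 * ((i - k).choose 2 : ℤ) - 2 * (((k + 1).choose 2 : ℤ)) + (i : ℤ)) *
          qb (2 * k) i * qb i k ^ 2 := by
    intro i
    induction i using Nat.strong_induction_on with
    | _ i ih =>
      intro hki
      rcases lt_or_ge (2 * k) i with h | h
      · rw [hPsupp 2 k i (Or.inr h), qb_eq_zero_of_lt h]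
        ring
      · have h₁ := (hPid 2 one_le_two k i hki).symm.trans (qb_sq_mul_qb_sq_eq_sum k i hki)
        rw [min_eq_left h, ← Ico_insert_right hki, sum_insert right_notMem_Ico,
          sum_insert right_notMem_Ico, sum_congr rfl fun j hj => by
            rw [ih j (mem_Ico.mp hj).2 (mem_Ico.mp hj).1]] at h₁
        refine mul_left_cancel₀ ?_ (add_right_cancel h₁)
        exact mul_ne_zero (mul_ne_zero (isUnit_T _).ne_zero (qb_ne_zero i 0)) (qb_ne_zero i i)
  refine ⟨hmain i hki, ?_⟩
  rw [hmain i hki, ← mul_assoc, ← mul_assoc, ← T_add]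
  congr 3
  ring
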